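/- Let Φ ∈ ℂ^{m×n}, let Ξ ⊆ {1,…,n} with |Ξ| = S, and let x_1,…,x_P ∈ ℂ^n satisfy supp(x_p) ⊆ Ξ for all p. Set y_p = Φ x_p and let Y ∈ ℂ^{m×P} be the matrix with columns y_1,…,y_P. If 2S < spark(Φ) − 1 + rank(Y), then for any x'_1,…,x'_P ∈ ℂ^n for which there exists a set Ξ' ⊆ {1,…,n} with |Ξ'| ≤ S and supp(x'_p) ⊆ Ξ' for all p, and y_p = Φ x'_p for all p, one has x'_p = x_p for every p. -/

import Mathlib

open Matrix

/-- The spark of a matrix: the smallest cardinality of a linearly dependent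
set of its columns. -/
noncomputable def Matrix.spark {K : Type*} [Field K] {m n : ℕ}
    (Φ : Matrix (Fin m) (Fin n) K) : ℕ :=
  sInf {k | ∃ s : Finset (Fin n), s.card = k ∧
    ¬ LinearIndependent K (fun j : {v // v ∈ s} => fun i => Φ i j.1)}

section SpanOfColumns

variable {K : Type*} [Field K] {m n : ℕ}

/-- Any set of fewer than `Φ.spark` columns is linearly independent. -/
theorem Matrix.linearIndependent_col_of_card_lt_spark (Φ : Matrix (Fin m) (Fin n) K)
    {s : Finset (Fin n)} (hs : s.card < Φ.spark) :
    LinearIndependent K (fun j : {v // v ∈ s} => Φ.col j.1) := by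
  by_contra h
  exact hs.not_ge (Nat.sInf_le ⟨s, rfl, h⟩)

/-- A set containing the support of a nonzero kernel vector has at least `Φ.spark` elements. -/
theorem Matrix.spark_le_card_of_mulVec_eq_zero (Φ : Matrix (Fin m) (Fin n) K)
    {s : Finset (Fin n)} {z : Fin n → K} (hz : z ≠ 0)
    (hzs : Function.support z ⊆ ↑s) (hΦz : Φ.mulVec z = 0) :
    Φ.spark ≤ s.card := by
  by_contra! h
  have hli : LinearIndepOn K Φ.col (s : Set (Fin n)) :=
    Φ.linearIndependent_col_of_card_lt_spark h
  rw [linearIndepOn_finset_iff] at hli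
  have hsum : ∑ j ∈ s, z j • Φ.col j = 0 := by
    rw [← hΦz, mulVec_eq_sum]
    simp only [op_smul_eq_smul]
    refine (Finset.sum_subset (Finset.subset_univ s) fun j _ hj => ?_).trans ?_
    · rw [Function.notMem_support.1 fun h' => hj (hzs h'), zero_smul]
    · rfl
  refine hz (funext fun j => ?_)
  by_contra hj
  exact hj (hli z hsum j (hzs hj))

/-- The image of a vector lies in the span of the columns indexed by its support. -/
theorem Matrix.mulVec_mem_span_col_image (Φ : Matrix (Fin m) (Fin n) K)
    {s : Set (Fin n)} {z : Fin n → K} (hzs : Function.support z ⊆ s) :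
    Φ.mulVec z ∈ Submodule.span K (Φ.col '' s) := by
  rw [mulVec_eq_sum]
  simp only [op_smul_eq_smul]
  refine Submodule.sum_mem _ fun j _ => ?_
  by_cases hj : z j = 0
  · simp [hj]
  · exact Submodule.smul_mem _ _ (Submodule.subset_span ⟨j, hzs hj, rfl⟩)

/-- The columns indexed by `s` span a space of dimension at most `s.card`. -/
theorem Matrix.finrank_span_col_image_le (Φ : Matrix (Fin m) (Fin n) K) (s : Finset (Fin n)) :
    Module.finrank K (Submodule.span K (Φ.col '' (s : Set (Fin n)))) ≤ s.card := by
  classical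
  rw [← Finset.coe_image]
  exact (finrank_span_finset_le_card _).trans Finset.card_image_le

/-- A set of at least `Φ.spark` columns spans a space of dimension at least `Φ.spark - 1`. -/
theorem Matrix.spark_sub_one_le_finrank_span (Φ : Matrix (Fin m) (Fin n) K)
    {s : Finset (Fin n)} (hs : Φ.spark ≤ s.card) :
    Φ.spark - 1 ≤ Module.finrank K (Submodule.span K (Φ.col '' (s : Set (Fin n)))) := by
  rcases Nat.eq_zero_or_pos Φ.spark with h0 | h0
  · simp [h0]
  obtain ⟨t, hts, ht⟩ := Finset.exists_subset_card_eq (show Φ.spark - 1 ≤ s.card by omega)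
  have hli := Φ.linearIndependent_col_of_card_lt_spark (s := t) (by omega)
  have hcard := finrank_span_eq_card hli
  rw [Fintype.card_coe, ht] at hcard
  rw [← hcard]
  refine Submodule.finrank_mono (Submodule.span_mono ?_)
  rintro _ ⟨j, rfl⟩
  exact ⟨j.1, hts j.2, rfl⟩

end SpanOfColumns

/-- MMV uniqueness (special case of Theorem 1 with a common measurement
matrix): if the `x p` are jointly `S`-sparse with common support `Ξ`,
`y p = Φ (x p)`, `Y` has columns `y p`, and `2S < spark(Φ) - 1 + rank(Y)`,
then `(x p)` is the unique jointly `S`-sparse solution. -/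
theorem mmv_uniqueness {m n P S : ℕ}
    (Φ : Matrix (Fin m) (Fin n) ℂ)
    (Ξ : Finset (Fin n)) (hΞcard : Ξ.card = S)
    (x : Fin P → Fin n → ℂ)
    (hxsupp : ∀ p, Function.support (x p) ⊆ ↑Ξ)
    (y : Fin P → Fin m → ℂ)
    (hy : ∀ p, y p = Φ.mulVec (x p))
    (Y : Matrix (Fin m) (Fin P) ℂ)
    (hY : ∀ i p, Y i p = y p i)
    (hcond : (2 * S : ℤ) < (Φ.spark : ℤ) - 1 + Y.rank) :
    ∀ x' : Fin P → Fin n → ℂ,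
      (∃ Ξ' : Finset (Fin n), Ξ'.card ≤ S ∧ ∀ p, Function.support (x' p) ⊆ ↑Ξ') →
      (∀ p, y p = Φ.mulVec (x' p)) →
      ∀ p, x' p = x p := by
  classical
  rintro x' ⟨Ξ', hΞ'card, hx'supp⟩ hy' p
  by_contra hne
  have hcard : Φ.spark ≤ (Ξ ∪ Ξ').card := by
    refine Φ.spark_le_card_of_mulVec_eq_zero (sub_ne_zero.2 hne) ?_ ?_
    · refine (Function.support_sub _ _).trans ?_
      rw [Finset.coe_union, Set.union_comm]
      exact Set.union_subset_union (hxsupp p) (hx'supp p)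
    · rw [mulVec_sub, ← hy, ← hy', sub_self]
  have hlower := Φ.spark_sub_one_le_finrank_span hcard
  rw [Finset.coe_union, Set.image_union, Submodule.span_union] at hlower
  have hrank : Y.rank ≤ Module.finrank ℂ
      ↥(Submodule.span ℂ (Φ.col '' (Ξ : Set (Fin n))) ⊓
        Submodule.span ℂ (Φ.col '' (Ξ' : Set (Fin n)))) := by
    rw [rank_eq_finrank_span_cols]
    refine Submodule.finrank_mono (Submodule.span_le.2 ?_)
    rintro _ ⟨q, rfl⟩
    have hcol : Y.col q = y q := funext fun i => hY i q
    rw [hcol]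
    exact ⟨hy q ▸ Φ.mulVec_mem_span_col_image (hxsupp q),
      hy' q ▸ Φ.mulVec_mem_span_col_image (hx'supp q)⟩
  have hdim := Submodule.finrank_sup_add_finrank_inf_eq
    (Submodule.span ℂ (Φ.col '' (Ξ : Set (Fin n))))
    (Submodule.span ℂ (Φ.col '' (Ξ' : Set (Fin n))))
  have hle := Φ.finrank_span_col_image_le Ξ
  have hle' := Φ.finrank_span_col_image_le Ξ'
  omega
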